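/- For x ≥ 2, x^{1−δ} ≤ h ≤ x with 0 ≤ δ < 1, and 1 ≤ y ≤ 2√(x+h), one has Σ_{y < m ≤ 2√(x+h), m square-free} #{x < p ≤ x+h : p ∤ mN_E, a_p ≠ 0, m² divides |Ē(𝔽_p)|} ≪ (h/y)(log x)³ + √x (log x)⁴. -/

import Mathlib

/-!
STATEMENT 16: For `x ≥ 2`, `x^{1−δ} ≤ h ≤ x` with `0 ≤ δ < 1`, and `1 ≤ y ≤ 2√(x+h)`,
`Σ_{y < m ≤ 2√(x+h), m square-free} #{x < p ≤ x+h : p ∤ mN_E, a_p ≠ 0, m² ∣ |Ē(𝔽_p)|}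
  ≪ (h/y)(log x)³ + √x (log x)⁴`.

Mathlib has no theory of reduction of elliptic curves or complex multiplication, so the
arithmetic data of the curve is packaged as a structure, including the Deuring fact used in
the proof: for ordinary `p ∤ 6N_E`, `p` splits in `K` as `p = π_p π̄_p` with
`N(π_p) = p` and `N(π_p − 1) = |Ē(𝔽_p)|`.
-/

open NumberField

/-- Data of an elliptic curve `E/ℚ` of conductor `N_E` with CM by the full ring of integers
of an imaginary quadratic field `K` of class number one: `card p = |Ē(𝔽_p)|` for good
primes `p`, subject to Hasse's bound and Deuring's splitting. -/
structure CMCurveData where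
  /-- the CM field `K`, an imaginary quadratic field of class number one -/
  K : Type
  [fieldK : Field K]
  [numberFieldK : NumberField K]
  quadratic : Module.finrank ℚ K = 2
  imaginary : ∀ φ : K →+* ℝ, False
  classNumberOne : Nat.card (ClassGroup (𝓞 K)) = 1
  /-- the conductor `N_E` -/
  NE : ℕ
  NE_pos : 0 < NE
  /-- `card p = |Ē(𝔽_p)|` for primes `p ∤ N_E` (of good reduction) -/
  card : ℕ → ℕ
  /-- Hasse's bound: `|a_p| ≤ 2√p`, where `a_p = p + 1 - |Ē(𝔽_p)|` -/
  hasse : ∀ p : ℕ, p.Prime → ¬ p ∣ NE → ((p : ℤ) + 1 - card p) ^ 2 ≤ 4 * p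
  /-- Deuring: for ordinary `p ∤ 6N_E` one has `pO_K = (π_p)(π̄_p)` with `N(π_p) = p` and
  `N(π_p − 1) = |Ē(𝔽_p)|` -/
  ordinary_pi : ∀ p : ℕ, p.Prime → ¬ p ∣ 6 * NE → (p : ℤ) + 1 - card p ≠ 0 →
    ∃ π : 𝓞 K, Ideal.absNorm (Ideal.span {π}) = p ∧
      Ideal.absNorm (Ideal.span {π - 1}) = card p

attribute [instance] CMCurveData.fieldK CMCurveData.numberFieldK

/-- `a_p = p + 1 - |Ē(𝔽_p)|`. -/
def CMCurveData.ap (E : CMCurveData) (p : ℕ) : ℤ :=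
  (p : ℤ) + 1 - E.card p

/-- `#{x < p ≤ x+h : p ∤ mN_E, a_p ≠ 0, m² ∣ |Ē(𝔽_p)|}`. -/
noncomputable def countDivisible (E : CMCurveData) (x h : ℝ) (m : ℕ) : ℕ :=
  Nat.card {p : ℕ | p.Prime ∧ x < (p : ℝ) ∧ (p : ℝ) ≤ x + h ∧ ¬ p ∣ m * E.NE ∧
    E.ap p ≠ 0 ∧ m ^ 2 ∣ E.card p}

lemma packing (s : Finset ℂ) (m r R : ℝ) (hm : 0 < m) (hr : 0 ≤ r) (hrR : r ≤ R)
    (hmR : m ≤ 2 * R) (hs : ∀ z ∈ s, r ≤ ‖z‖ ∧ ‖z‖ ≤ R)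
    (sep : ∀ z ∈ s, ∀ w ∈ s, z ≠ w → m ≤ ‖z - w‖) :
    (s.card : ℝ) ≤ 4 * (R ^ 2 - r ^ 2) / m ^ 2 + 8 * (R + r) / m := by
  set a := max (r - m / 2) 0 with ha
  have ha0 : 0 ≤ a := le_max_right _ _
  have hdisj : (s : Set ℂ).PairwiseDisjoint (fun z => Metric.ball z (m / 2)) := by
    intro z hz w hw hzw
    apply Metric.ball_disjoint_ball
    have := sep z hz w hw hzw
    rw [dist_eq_norm]; linarith
  have h1 : MeasureTheory.volume (⋃ z ∈ s, Metric.ball z (m / 2))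
      = s.card * (ENNReal.ofReal (m / 2) ^ 2 * NNReal.pi) := by
    rw [MeasureTheory.measure_biUnion_finset hdisj (fun z _ => Metric.isOpen_ball.measurableSet)]
    simp [Complex.volume_ball]
  have hd2 : Disjoint (⋃ z ∈ s, Metric.ball z (m / 2)) (Metric.ball (0 : ℂ) a) := by
    rw [Set.disjoint_left]
    intro w hw hw2
    simp only [Set.mem_iUnion, Metric.mem_ball, exists_prop, dist_zero_right] at hw hw2
    obtain ⟨z, hz, hzw⟩ := hw
    have h3 := (hs z hz).1
    rw [dist_eq_norm] at hzw
    have h4 : ‖z‖ ≤ ‖w‖ + ‖w - z‖ := by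
      have := norm_sub_le w (w - z); simpa using this
    rcases lt_max_iff.1 hw2 with h | h
    · linarith
    · linarith [norm_nonneg w]
  have hsub : (⋃ z ∈ s, Metric.ball z (m / 2)) ∪ Metric.ball (0 : ℂ) a ⊆
      Metric.ball (0 : ℂ) (R + m / 2) := by
    apply Set.union_subset
    · intro w hw
      simp only [Set.mem_iUnion, Metric.mem_ball, exists_prop, dist_zero_right] at hw ⊢
      obtain ⟨z, hz, hzw⟩ := hw
      rw [dist_eq_norm] at hzw
      have h4 : ‖w‖ ≤ ‖z‖ + ‖w - z‖ := by
        have := norm_add_le z (w - z); simpa using this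
      linarith [(hs z hz).2]
    · apply Metric.ball_subset_ball
      apply max_le <;> linarith
  have h2 := MeasureTheory.measure_mono (μ := MeasureTheory.volume) hsub
  rw [MeasureTheory.measure_union hd2 Metric.isOpen_ball.measurableSet, h1,
    Complex.volume_ball, Complex.volume_ball] at h2
  have h5 : (s.card : ℝ) * ((m / 2) ^ 2 * Real.pi) + a ^ 2 * Real.pi
      ≤ (R + m / 2) ^ 2 * Real.pi := by
    have h6 := ENNReal.toReal_mono (by finiteness) h2
    rw [ENNReal.toReal_add (by finiteness) (by finiteness)] at h6
    simpa [ENNReal.toReal_ofReal, ha0, hm.le, (by linarith : 0 ≤ R + m / 2),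
      (by linarith : 0 ≤ m / 2)] using h6
  have h7 : (s.card : ℝ) * (m / 2) ^ 2 + a ^ 2 ≤ (R + m / 2) ^ 2 := by
    have := Real.pi_pos
    by_contra hc
    push Not at hc
    nlinarith
  have h8 : (R + m / 2) ^ 2 - a ^ 2 ≤ R ^ 2 - r ^ 2 + 2 * m * (R + r) := by
    rcases le_total (r - m / 2) 0 with h | h
    · rw [ha, max_eq_right h]; nlinarith
    · rw [ha, max_eq_left h]; nlinarith
  have h9 : 4 * (R ^ 2 - r ^ 2) / m ^ 2 + 8 * (R + r) / m
      = (R ^ 2 - r ^ 2 + 2 * m * (R + r)) / (m / 2) ^ 2 := by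
    field_simp; ring
  rw [h9, le_div_iff₀ (by positivity)]
  linarith

lemma local_ideals (K : Type) [Field K] [NumberField K] (h2 : Module.finrank ℚ K = 2)
    (q : ℕ) (hq : q.Prime) :
    ∃ f : Fin 3 → Ideal (𝓞 K),
      (∀ i, ∀ γ ∈ f i, q ^ 2 ∣ Ideal.absNorm (Ideal.span {γ})) ∧
      ∀ β : 𝓞 K, q ^ 2 ∣ Ideal.absNorm (Ideal.span {β}) → ∃ i, β ∈ f i := by
  have hN : Ideal.absNorm (Ideal.span {(q : 𝓞 K)}) = q ^ 2 := by
    rw [Ideal.absNorm_span_natCast, RingOfIntegers.rank, h2]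
  have key : ∀ I : Ideal (𝓞 K), q ∣ Ideal.absNorm I →
      ∃ P : Ideal (𝓞 K), P.IsMaximal ∧ P ∣ I ∧ P ∣ Ideal.span {(q : 𝓞 K)} := by
    intro I hI
    obtain ⟨P, hP, hPu, hPI⟩ := Ideal.exists_isMaximal_dvd_of_dvd_absNorm' hq I hI
    refine ⟨P, hP, hPI, ?_⟩
    rw [Ideal.dvd_span_singleton]
    have : (q : ℤ) ∈ P.under ℤ := by rw [hPu]; exact Ideal.mem_span_singleton_self _
    rw [Ideal.mem_comap] at this
    simpa using this
  have hdv : ∀ (J : Ideal (𝓞 K)), Ideal.absNorm J = q ^ 2 → ∀ γ ∈ J,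
      q ^ 2 ∣ Ideal.absNorm (Ideal.span {γ}) := by
    intro J hJ γ hγ
    rw [← hJ]
    exact Ideal.absNorm_dvd_absNorm_of_le ((Ideal.span_singleton_le_iff_mem _).2 hγ)
  obtain ⟨P, hP, -, hPq⟩ := key (Ideal.span {(q : 𝓞 K)}) (by rw [hN]; exact dvd_pow_self _ two_ne_zero)
  obtain ⟨P', hPP⟩ := hPq
  have hmul : Ideal.absNorm P * Ideal.absNorm P' = q ^ 2 := by rw [← map_mul, ← hPP, hN]
  have hP1 : Ideal.absNorm P ≠ 1 := fun h => hP.ne_top (Ideal.absNorm_eq_one_iff.1 h)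
  obtain ⟨k, hk, hPk⟩ := (Nat.dvd_prime_pow hq).1 (Dvd.intro _ hmul)
  have hq0 := hq.pos
  have hmaxeq : ∀ A B : Ideal (𝓞 K), A.IsMaximal → B.IsMaximal → A ∣ B → A = B := by
    intro A B hA hB h
    exact (hB.eq_of_le hA.ne_top (Ideal.dvd_iff_le.1 h)).symm
  interval_cases k
  · exact absurd (by rw [hPk, pow_zero]) hP1
  · rw [pow_one] at hPk
    have hPk' : Ideal.absNorm P' = q := by
      rw [hPk, sq] at hmul
      exact Nat.eq_of_mul_eq_mul_left hq0 hmul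
    have hP'p : P'.IsPrime := Ideal.isPrime_of_irreducible_absNorm (by rw [hPk']; exact hq)
    have hP'0 : P' ≠ ⊥ := by
      rintro rfl; simp at hPk'; omega
    have hP' : P'.IsMaximal := hP'p.isMaximal hP'0
    have hor : ∀ Q : Ideal (𝓞 K), Q.IsMaximal → Q ∣ Ideal.span {(q : 𝓞 K)} → Q = P ∨ Q = P' := by
      intro Q hQ h
      rw [hPP, Ideal.dvd_iff_le] at h
      rcases (hQ.isPrime.mul_le).1 h with h | h
      · exact Or.inl (hmaxeq _ _ hQ hP (Ideal.dvd_iff_le.2 h))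
      · exact Or.inr (hmaxeq _ _ hQ hP' (Ideal.dvd_iff_le.2 h))
    refine ⟨![P * P, P * P', P' * P'], ?_, ?_⟩
    · intro i
      apply hdv
      fin_cases i <;> simp [hPk, hPk', sq]
    · intro β hβ
      obtain ⟨Q, hQ, ⟨J, hJ⟩, hQq⟩ := key _ ((dvd_pow_self q two_ne_zero).trans hβ)
      have hQN : Ideal.absNorm Q = q := by
        rcases hor Q hQ hQq with h | h <;> rw [h] <;> assumption
      have hJq : q ∣ Ideal.absNorm J := by
        rw [hJ, map_mul, hQN, sq] at hβ
        exact Nat.dvd_of_mul_dvd_mul_left hq0 hβ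
      obtain ⟨Q2, hQ2, ⟨J2, hJ2⟩, hQ2q⟩ := key _ hJq
      have hmem : β ∈ Q * Q2 := by
        have : Q * Q2 ∣ Ideal.span {β} := ⟨J2, by rw [hJ, hJ2, mul_assoc]⟩
        rwa [Ideal.dvd_span_singleton] at this
      rcases hor Q hQ hQq with rfl | rfl <;> rcases hor Q2 hQ2 hQ2q with rfl | rfl
      · exact ⟨0, hmem⟩
      · exact ⟨1, hmem⟩
      · exact ⟨1, by rw [mul_comm] at hmem; exact hmem⟩
      · exact ⟨2, hmem⟩
  · have hPk' : Ideal.absNorm P' = 1 := by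
      rw [hPk] at hmul
      exact Nat.eq_of_mul_eq_mul_left (by positivity) (hmul.trans (mul_one _).symm)
    rw [Ideal.absNorm_eq_one_iff] at hPk'
    refine ⟨fun _ => P, fun _ => hdv P hPk, ?_⟩
    intro β hβ
    obtain ⟨Q, hQ, h1, hQq⟩ := key _ ((dvd_pow_self q two_ne_zero).trans hβ)
    rw [hPP, hPk', Ideal.mul_top] at hQq
    rw [hmaxeq _ _ hQ hP hQq, Ideal.dvd_span_singleton] at h1
    exact ⟨0, h1⟩

lemma exists_embedding (K : Type) [Field K] [NumberField K] (h2 : Module.finrank ℚ K = 2)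
    (him : ∀ φ : K →+* ℝ, False) :
    ∃ φ : K →+* ℂ, ∀ β : 𝓞 K, (Ideal.absNorm (Ideal.span {β}) : ℝ) = ‖φ β‖ ^ 2 := by
  have hr : InfinitePlace.nrRealPlaces K = 0 := by
    classical
    rw [InfinitePlace.nrRealPlaces, Fintype.card_eq_zero_iff]
    exact ⟨fun w => him (InfinitePlace.embedding_of_isReal w.2)⟩
  have hc := InfinitePlace.card_add_two_mul_card_eq_rank K
  have hcard : Fintype.card (InfinitePlace K) = 1 := by
    rw [InfinitePlace.card_eq_nrRealPlaces_add_nrComplexPlaces]; omega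
  obtain ⟨w, hw⟩ := Fintype.card_eq_one_iff.1 hcard
  have hwc : ¬ InfinitePlace.IsReal w := fun h => him (InfinitePlace.embedding_of_isReal h)
  refine ⟨w.embedding, fun β => ?_⟩
  have h := InfinitePlace.prod_eq_abs_norm (β : K)
  rw [Fintype.prod_eq_single w (fun v hv => absurd (hw v) hv)] at h
  rw [InfinitePlace.norm_embedding_eq, Ideal.absNorm_span_singleton]
  rw [InfinitePlace.mult, if_neg hwc] at h
  rw [h, ← Algebra.coe_norm_int, Nat.cast_natAbs]
  push_cast
  rfl

lemma pow_card_eq (k m : ℕ) (hm : Squarefree m) :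
    ((k + 1 : ℕ) : ℝ) ^ m.primeFactors.card = ∑ d ∈ m.divisors, (k : ℝ) ^ d.primeFactors.card := by
  have h := Finset.sum_pow_mul_eq_add_pow (k : ℝ) 1 m.primeFactors
  push_cast
  rw [← h, ← Nat.divisors_filter_squarefree_of_squarefree hm,
    Nat.sum_divisors_filter_squarefree hm.ne_zero]
  simp only [Nat.factors_eq]
  apply Finset.sum_congr rfl
  intro t ht
  simp only [one_pow, mul_one]
  have ht' : ∀ p ∈ t, p.Prime := fun p hp => Nat.prime_of_mem_primeFactors (Finset.mem_powerset.1 ht hp)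
  have h3 := Nat.primeFactors_prod ht'
  rw [Finset.prod_val]
  simp only [id_def]
  rw [h3]
lemma sum_bound (M k : ℕ) :
    ∑ m ∈ Finset.Ioc 0 M, (if Squarefree m then ((k : ℝ) ^ m.primeFactors.card / m) else 0)
      ≤ (∑ m ∈ Finset.Ioc 0 M, (1 / (m : ℝ))) ^ k := by
  set H := ∑ m ∈ Finset.Ioc 0 M, (1 / (m : ℝ)) with hH
  induction k with
  | zero =>
    rw [pow_zero]
    calc _ ≤ ∑ m ∈ Finset.Ioc 0 M, (if m = 1 then (1 : ℝ) else 0) := by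
          apply Finset.sum_le_sum
          intro m hm
          rw [Finset.mem_Ioc] at hm
          by_cases h1 : m = 1
          · subst h1; simp
          · have : m.primeFactors.card ≠ 0 := by
              rw [Finset.card_ne_zero, Nat.nonempty_primeFactors]; omega
            simp [h1, this]
      _ ≤ 1 := by rw [Finset.sum_ite_eq']; split_ifs <;> norm_num
  | succ k ih =>
    set g : ℕ → ℝ := fun m => if Squarefree m then ((k : ℝ) ^ m.primeFactors.card / m) else 0 with hg
    have hg0 : ∀ m, 0 ≤ g m := fun m => by
      simp only [hg]; split_ifs <;> positivity
    calc _ ≤ ∑ m ∈ Finset.Ioc 0 M, ∑ ab ∈ m.divisorsAntidiagonal, g ab.1 * (1 / (ab.2 : ℝ)) := by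
          apply Finset.sum_le_sum
          intro m hm
          split_ifs with hs
          · rw [pow_card_eq k m hs, Finset.sum_div, ← Nat.map_div_right_divisors, Finset.sum_map]
            apply le_of_eq
            apply Finset.sum_congr rfl
            intro d hd
            have hdm := Nat.dvd_of_mem_divisors hd
            have hd0 : (d : ℝ) ≠ 0 := by
              have := Nat.pos_of_mem_divisors hd; positivity
            change _ = g d * (1 / ((m / d : ℕ) : ℝ))
            simp only [hg]
            rw [if_pos (hs.squarefree_of_dvd hdm), Nat.cast_div hdm hd0]
            field_simp
          · exact Finset.sum_nonneg fun ab _ => mul_nonneg (hg0 _) (by positivity)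
      _ ≤ ∑ ab ∈ Finset.Ioc 0 M ×ˢ Finset.Ioc 0 M, g ab.1 * (1 / (ab.2 : ℝ)) := by
          rw [← Finset.sum_biUnion]
          · apply Finset.sum_le_sum_of_subset_of_nonneg
            · intro ab hab
              simp only [Finset.mem_biUnion, Nat.mem_divisorsAntidiagonal, Finset.mem_Ioc,
                Finset.mem_product] at hab ⊢
              obtain ⟨m, ⟨h0, hM⟩, h1, h2⟩ := hab
              have ha : 0 < ab.1 := Nat.pos_of_ne_zero (by rintro h; simp [h] at h1; omega)
              have hb : 0 < ab.2 := Nat.pos_of_ne_zero (by rintro h; simp [h] at h1; omega)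
              exact ⟨⟨ha, by nlinarith⟩, ⟨hb, by nlinarith⟩⟩
            · intro ab _ _
              exact mul_nonneg (hg0 _) (by positivity)
          · intro a _ b _ hab
            rw [Function.onFun, Finset.disjoint_left]
            intro c hc hc'
            rw [Nat.mem_divisorsAntidiagonal] at hc hc'
            exact hab (hc.1.symm.trans hc'.1)
      _ = (∑ m ∈ Finset.Ioc 0 M, g m) * H := by
          rw [Finset.sum_product, Finset.sum_mul_sum]
      _ ≤ H ^ k * H := by
          apply mul_le_mul_of_nonneg_right ih
          exact Finset.sum_nonneg fun _ _ => by positivity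
      _ = _ := (pow_succ _ _).symm

lemma count_bound (E : CMCurveData) (x h : ℝ) (m : ℕ) (hx : 2 ≤ x) (hh : 0 ≤ h)
    (hm : Squarefree m) (hmR : (m : ℝ) ≤ 2 * Real.sqrt (x + h)) :
    (countDivisible E x h m : ℝ) ≤ 1 + 3 ^ m.primeFactors.card *
      (4 * h / m ^ 2 + 8 * (Real.sqrt (x + h) + Real.sqrt x) / m) := by
  classical
  set S : Set ℕ := {p : ℕ | p.Prime ∧ x < (p : ℝ) ∧ (p : ℝ) ≤ x + h ∧ ¬ p ∣ m * E.NE ∧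
    E.ap p ≠ 0 ∧ m ^ 2 ∣ E.card p} with hS
  have hfin : S.Finite := by
    apply (Set.finite_Iic ⌊x + h⌋₊).subset
    intro p hp
    exact Nat.le_floor hp.2.2.1
  set T := hfin.toFinset with hT
  have hcount : countDivisible E x h m = T.card := by
    rw [countDivisible, ← hS, hT, ← Set.ncard_eq_toFinset_card S hfin]
    rfl
  have h1 : T.card ≤ (T.erase 3).card + 1 := by
    have := Finset.pred_card_le_card_erase (s := T) (a := 3)
    omega
  obtain ⟨φ, hφ⟩ := exists_embedding E.K E.quadratic E.imaginary
  have hpi : ∀ p ∈ T.erase 3, ∃ π : 𝓞 E.K, Ideal.absNorm (Ideal.span {π}) = p ∧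
      Ideal.absNorm (Ideal.span {π - 1}) = E.card p := by
    intro p hp
    rw [Finset.mem_erase, hT, Set.Finite.mem_toFinset] at hp
    obtain ⟨hp3, hpp, hxp, -, hnd, hap, -⟩ := hp
    apply E.ordinary_pi p hpp _ hap
    intro hd
    rcases hpp.dvd_mul.1 hd with h6 | h6
    · rw [show 6 = 2 * 3 by rfl, hpp.dvd_mul, Nat.prime_dvd_prime_iff_eq hpp Nat.prime_two,
        Nat.prime_dvd_prime_iff_eq hpp Nat.prime_three] at h6
      rcases h6 with h6 | h6
      · subst h6; norm_num at hxp; linarith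
      · exact hp3 h6
    · exact hnd (h6.mul_left m)
  choose! pi hpi1 hpi2 using hpi
  have hloc := fun (q : ℕ) (hq : q.Prime) => local_ideals E.K E.quadratic q hq
  choose! f hf1 hf2 using hloc
  have hc : ∀ p ∈ T.erase 3, ∃ c : m.primeFactors → Fin 3,
      ∀ q : m.primeFactors, pi p - 1 ∈ f (q : ℕ) (c q) := by
    intro p hp
    have hp' := hp
    rw [Finset.mem_erase, hT, Set.Finite.mem_toFinset] at hp
    have hdvd := hp.2.2.2.2.2.2
    have : ∀ q : m.primeFactors, ∃ i, pi p - 1 ∈ f q i := by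
      intro q
      apply hf2 q (Nat.prime_of_mem_primeFactors q.2)
      rw [hpi2 p hp']
      exact (pow_dvd_pow_of_dvd (Nat.dvd_of_mem_primeFactors q.2) 2).trans hdvd
    choose c hc using this
    exact ⟨c, hc⟩
  choose! c hc using hc
  have hm0 : 0 < m := Nat.pos_of_ne_zero hm.ne_zero
  set B := 4 * h / (m : ℝ) ^ 2 + 8 * (Real.sqrt (x + h) + Real.sqrt x) / m with hB
  have hnorm : ∀ p ∈ T.erase 3, ‖φ (pi p)‖ ^ 2 = p := by
    intro p hp
    rw [← hφ, hpi1 p hp]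
  have hfib : ∀ c0 : m.primeFactors → Fin 3,
      (((T.erase 3).filter (fun p => c p = c0)).card : ℝ) ≤ B := by
    intro c0
    set U := (T.erase 3).filter (fun p => c p = c0) with hU
    have hUT : ∀ p ∈ U, p ∈ T.erase 3 := fun p hp => (Finset.mem_filter.1 hp).1
    have hinj : Set.InjOn (fun p => φ (pi p)) U := by
      intro p hp p' hp' heq
      have e1 := hnorm p (hUT p hp)
      have e2 := hnorm p' (hUT p' hp')
      simp only at heq
      rw [heq, e2] at e1
      exact_mod_cast e1.symm
    rw [← Finset.card_image_of_injOn hinj]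
    have hpk := packing (U.image (fun p => φ (pi p))) m (Real.sqrt x) (Real.sqrt (x + h))
      (by exact_mod_cast hm0) (Real.sqrt_nonneg _) (Real.sqrt_le_sqrt (by linarith)) hmR ?_ ?_
    · rw [Real.sq_sqrt (by linarith), Real.sq_sqrt (by linarith)] at hpk
      rw [hB]
      convert hpk using 4
      ring
    · intro z hz
      obtain ⟨p, hp, rfl⟩ := Finset.mem_image.1 hz
      have e1 := hnorm p (hUT p hp)
      have e2 := hUT p hp
      rw [Finset.mem_erase, hT, Set.Finite.mem_toFinset] at e2
      constructor
      · apply Real.sqrt_le_iff.2 ⟨norm_nonneg _, _⟩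
        rw [e1]; exact e2.2.2.1.le
      · apply Real.le_sqrt_of_sq_le
        rw [e1]; exact e2.2.2.2.1
    · intro z hz w hw hzw
      obtain ⟨p, hp, rfl⟩ := Finset.mem_image.1 hz
      obtain ⟨p', hp', rfl⟩ := Finset.mem_image.1 hw
      have hc1 := hc p (hUT p hp)
      have hc2 := hc p' (hUT p' hp')
      rw [(Finset.mem_filter.1 hp).2] at hc1
      rw [(Finset.mem_filter.1 hp').2] at hc2
      have hdq : ∀ q ∈ m.primeFactors,
          q ^ 2 ∣ Ideal.absNorm (Ideal.span {pi p - pi p'}) := by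
        intro q hq
        apply hf1 q (Nat.prime_of_mem_primeFactors hq) (c0 ⟨q, hq⟩)
        have := Ideal.sub_mem _ (hc1 ⟨q, hq⟩) (hc2 ⟨q, hq⟩)
        simpa using this
      have hdm : m ^ 2 ∣ Ideal.absNorm (Ideal.span {pi p - pi p'}) := by
        conv_lhs => rw [← Nat.prod_primeFactors_of_squarefree hm]
        rw [← Finset.prod_pow]
        apply Finset.prod_dvd_of_isRelPrime
        · intro q hq q' hq' hne
          rw [Function.onFun, ← Nat.coprime_iff_isRelPrime]
          exact Nat.Coprime.pow 2 2 ((Nat.coprime_primes (Nat.prime_of_mem_primeFactors hq)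
            (Nat.prime_of_mem_primeFactors hq')).2 hne)
        · intro q hq
          exact hdq q hq
      have hne : Ideal.absNorm (Ideal.span {pi p - pi p'}) ≠ 0 := by
        rw [Ne, Ideal.absNorm_eq_zero_iff, Ideal.span_singleton_eq_bot, sub_eq_zero]
        intro h; rw [h] at hzw; exact hzw rfl
      have hle := Nat.le_of_dvd (Nat.pos_of_ne_zero hne) hdm
      have hle' : (m : ℝ) ^ 2 ≤ ‖φ (pi p) - φ (pi p')‖ ^ 2 := by
        have := hφ (pi p - pi p')
        rw [RingOfIntegers.coe_eq_algebraMap, map_sub, map_sub] at this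
        rw [← this]
        exact_mod_cast hle
      exact (pow_le_pow_iff_left₀ (by positivity) (norm_nonneg _) two_ne_zero).1 hle'
  have hcard : ((T.erase 3).card : ℝ) ≤ 3 ^ m.primeFactors.card * B := by
    rw [Finset.card_eq_sum_card_fiberwise (f := c) (t := Finset.univ) (fun _ _ => by simp)]
    push_cast
    refine (Finset.sum_le_sum fun c0 _ => hfib c0).trans ?_
    rw [Finset.sum_const, nsmul_eq_mul]
    simp
  rw [hcount]
  have h1' : (T.card : ℝ) ≤ (T.erase 3).card + 1 := by exact_mod_cast h1
  linarith

/-- There is `C > 0` such that for every CM elliptic curve as above, all `0 ≤ δ < 1`,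
`x ≥ 2`, `x^{1−δ} ≤ h ≤ x` and `1 ≤ y ≤ 2√(x+h)`,
`Σ_{y < m ≤ 2√(x+h), m square-free} #{x < p ≤ x+h : p ∤ mN_E, a_p ≠ 0, m² ∣ |Ē(𝔽_p)|}
  ≤ C ((h/y)(log x)³ + √x (log x)⁴)`. -/
theorem sum_divisible_squarefree_short_interval :
    ∃ C : ℝ, 0 < C ∧ ∀ E : CMCurveData, ∀ δ x h y : ℝ, 0 ≤ δ → δ < 1 → 2 ≤ x →
      x ^ (1 - δ) ≤ h → h ≤ x → 1 ≤ y → y ≤ 2 * Real.sqrt (x + h) →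
        ∑ m ∈ Finset.Ioc ⌊y⌋₊ ⌊2 * Real.sqrt (x + h)⌋₊,
          (if Squarefree m then (countDivisible E x h m : ℝ) else 0) ≤
        C * (h / y * Real.log x ^ 3 + Real.sqrt x * Real.log x ^ 4) := by
  refine ⟨64 * 72, by norm_num, ?_⟩
  intro E δ x h y hδ0 hδ1 hx hxh hhx hy hyR
  have hh : 0 < h := lt_of_lt_of_le (Real.rpow_pos_of_pos (by linarith) _) hxh
  set R := Real.sqrt (x + h) with hR
  set M := ⌊2 * R⌋₊ with hM
  have hR0 : 0 ≤ R := Real.sqrt_nonneg _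
  have hrR : Real.sqrt x ≤ R := Real.sqrt_le_sqrt (by linarith)
  have hs0 : 0 ≤ Real.sqrt x := Real.sqrt_nonneg _
  have hR2 : R ≤ 2 * Real.sqrt x := by
    rw [hR]
    apply Real.sqrt_le_iff.2 ⟨by positivity, _⟩
    rw [mul_pow, Real.sq_sqrt (by linarith)]; linarith
  set A := 4 * h / y + 36 * Real.sqrt x with hA
  have hA0 : 0 ≤ A := by positivity
  have step : ∀ m ∈ Finset.Ioc ⌊y⌋₊ M,
      (if Squarefree m then (countDivisible E x h m : ℝ) else 0) ≤
      A * (if Squarefree m then (((3 : ℕ) : ℝ) ^ m.primeFactors.card / m) else 0) := by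
    intro m hm
    rw [Finset.mem_Ioc] at hm
    have hym : y < m := (Nat.floor_lt (by linarith)).1 hm.1
    have hmR : (m : ℝ) ≤ 2 * R := (Nat.le_floor_iff (by positivity)).1 hm.2
    have hm0 : (0 : ℝ) < m := by linarith
    split_ifs with hs
    · refine (count_bound E x h m hx hh.le hs hmR).trans ?_
      rw [← hR]
      push_cast
      set t := (3 : ℝ) ^ m.primeFactors.card with ht
      have ht1 : 1 ≤ t := one_le_pow₀ (by norm_num)
      have e1 : (1 : ℝ) ≤ t * (2 * R / m) := by
        have : 1 ≤ 2 * R / m := by rw [le_div_iff₀ hm0]; linarith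
        nlinarith
      have e2 : 4 * h / (m : ℝ) ^ 2 ≤ 4 * h / y / m := by
        rw [div_div]
        apply div_le_div_of_nonneg_left (by positivity) (by positivity)
        nlinarith
      have e3 : 8 * (R + Real.sqrt x) / m + 2 * R / m ≤ 36 * Real.sqrt x / m := by
        rw [← add_div]
        apply div_le_div_of_nonneg_right _ hm0.le
        nlinarith
      calc _ ≤ t * (2 * R / m) + t * (4 * h / y / m + 8 * (R + Real.sqrt x) / m) := by
            gcongr
        _ = t * (4 * h / y / m + (8 * (R + Real.sqrt x) / m + 2 * R / m)) := by ring
        _ ≤ t * (4 * h / y / m + 36 * Real.sqrt x / m) := by gcongr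
        _ = _ := by rw [hA]; ring
    · simp
  have hH0 : 0 ≤ ∑ m ∈ Finset.Ioc 0 M, (1 / (m : ℝ)) := Finset.sum_nonneg fun _ _ => by positivity
  set L := Real.log x with hL
  have hlog2 : 0.69 ≤ Real.log 2 := by linarith [Real.log_two_gt_d9]
  have hL2 : 0.69 ≤ L := hlog2.trans (Real.log_le_log (by norm_num) hx)
  have hHL : ∑ m ∈ Finset.Ioc 0 M, (1 / (m : ℝ)) ≤ 4 * L := by
    have e := harmonic_floor_le_one_add_log (2 * R) (by linarith)
    rw [← hM, harmonic_eq_sum_Icc] at e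
    push_cast at e
    have e2 : ∑ m ∈ Finset.Ioc 0 M, (1 / (m : ℝ)) = ∑ m ∈ Finset.Icc 1 M, (m : ℝ)⁻¹ := by
      simp only [one_div]; rfl
    rw [e2]
    refine e.trans ?_
    have e3 : Real.log (2 * R) ≤ 2 * Real.log 2 + L / 2 := by
      calc Real.log (2 * R) ≤ Real.log (2 * 2 * Real.sqrt x) :=
            Real.log_le_log (by linarith) (by linarith)
        _ = _ := by
            rw [Real.log_mul (by norm_num) (by positivity), Real.log_mul (by norm_num) (by norm_num),
              Real.log_sqrt (by linarith)]
            ring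
    have : Real.log 2 ≤ L := Real.log_le_log (by norm_num) hx
    linarith
  have hL0 : 0 ≤ L := by linarith
  calc _ ≤ ∑ m ∈ Finset.Ioc ⌊y⌋₊ M,
        A * (if Squarefree m then (((3 : ℕ) : ℝ) ^ m.primeFactors.card / m) else 0) :=
        Finset.sum_le_sum step
    _ ≤ ∑ m ∈ Finset.Ioc 0 M,
        A * (if Squarefree m then (((3 : ℕ) : ℝ) ^ m.primeFactors.card / m) else 0) := by
        apply Finset.sum_le_sum_of_subset_of_nonneg
        · exact Finset.Ioc_subset_Ioc_left (Nat.zero_le _)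
        · intro m _ _
          apply mul_nonneg hA0
          split_ifs <;> positivity
    _ = A * ∑ m ∈ Finset.Ioc 0 M,
        (if Squarefree m then (((3 : ℕ) : ℝ) ^ m.primeFactors.card / m) else 0) := by
        rw [Finset.mul_sum]
    _ ≤ A * (4 * L) ^ 3 := by
        apply mul_le_mul_of_nonneg_left _ hA0
        exact (sum_bound M 3).trans (pow_le_pow_left₀ hH0 hHL 3)
    _ = 256 * (h / y * L ^ 3) + 2304 * (Real.sqrt x * L ^ 3) := by rw [hA]; ring
    _ ≤ 64 * 72 * (h / y * L ^ 3) + 2304 * (Real.sqrt x * (2 * L ^ 4)) := by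
        have e1 : 0 ≤ h / y * L ^ 3 := by positivity
        have e2 : L ^ 3 ≤ 2 * L ^ 4 := by
          have : 0 ≤ L ^ 3 := by positivity
          nlinarith
        have e3 : Real.sqrt x * L ^ 3 ≤ Real.sqrt x * (2 * L ^ 4) := by gcongr
        linarith
    _ = _ := by ring
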